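/- For every partition Π of [0,T] and every (t,x) ∈ [0,T] × ℝ^d, the lower and the upper value functions along Π are deterministic: V^Π(t,x) = E[V^Π(t,x)] and U^Π(t,x) = E[U^Π(t,x)], P-almost surely; that is, the random variables V^Π(t,x) and U^Π(t,x) are almost surely constant. -/

import Mathlib

open MeasureTheory Set Filter Topology
open scoped unitInterval RealInnerProductSpace ENNReal NNReal

noncomputable section

namespace DGameFormal

/-! ### The canonical sample space `Ω = ([0,1]²)^ℕ` -/

/-- The sample space `Ω = ([0,1]²)^ℕ`.  The `j`-th coordinate mapping `ζ_{j+1}` of the paper is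
`ω ↦ ω j` (we use `0`-based indexing, so the paper's `ζ_j`, `j ≥ 1`, is `ω ↦ ω (j-1)`). -/
abbrev Omega : Type := ℕ → (I × I)

/-- `𝓕_j`: the σ-field generated by the first `j` coordinate mappings `ζ_1, …, ζ_j`. -/
def Fsig (j : ℕ) : MeasurableSpace Omega :=
  MeasurableSpace.comap (fun ω (i : Fin j) => ω (i : ℕ)) inferInstance

/-- `𝓖_{j+1}`: the σ-field generated by the first component of the coordinate `ζ_{j+1}`. -/
def Gsig (j : ℕ) : MeasurableSpace Omega :=
  MeasurableSpace.comap (fun ω => (ω j).1) inferInstance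

/-- `𝓗_{j+1}`: the σ-field generated by the second component of the coordinate `ζ_{j+1}`. -/
def Hsig (j : ℕ) : MeasurableSpace Omega :=
  MeasurableSpace.comap (fun ω => (ω j).2) inferInstance

/-- `P` is the countable product `λ₂^{⊗ℕ}` of the two-dimensional Lebesgue (Borel) measure on the
unit square: it has the prescribed finite-dimensional distributions. -/
def IsProductMeasure (P : Measure Omega) : Prop :=
  ∀ m : ℕ, P.map (fun ω (i : Fin m) => ω (i : ℕ))
      = Measure.pi (fun _ : Fin m => (volume : Measure (I × I)))

/-! ### Partitions of `[0,T]` -/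

/-- A partition `0 = t_0 < t_1 < ⋯ < t_n = T` of the interval `[0,T]`. -/
structure Partition (T : ℝ) where
  n : ℕ
  npos : 0 < n
  t : ℕ → ℝ
  map_zero : t 0 = 0
  map_last : t n = T
  mono : ∀ i < n, t i < t (i + 1)

/-- The mesh `|Π|`: the maximal distance between two neighbouring points of the partition. -/
def Partition.mesh {T : ℝ} (π : Partition T) : ℝ :=
  (Finset.range π.n).sup' (Finset.nonempty_range_iff.2 π.npos.ne') fun i => π.t (i + 1) - π.t i

open scoped Classical in
/-- For `t ∈ [t_i, t_{i+1})` the index `i` (and `n - 1` for `t ≥ t_{n-1}`). -/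
def Partition.idx {T : ℝ} (π : Partition T) (s : ℝ) : ℕ :=
  Nat.findGreatest (fun i => π.t i ≤ s) (π.n - 1)

/-! ### Admissible controls along a partition -/

variable (U V : Type) [MeasurableSpace U] [MeasurableSpace V]

/-- Admissible controls for Player 1 along the partition `π`: measurable processes `u` such that on
each interval `[t_{j-1}, t_j)` of the partition, `u` is a countable sum `Σ_k 1_{Γ_{j,k}} u^{j,k}`
where `(Γ_{j,k})_k ⊆ 𝓕_{j-1}` is a partition of `Ω` and each `u^{j,k}` is `𝓖_j`-measurable. -/
def AdmControl1 {T : ℝ} (π : Partition T) : Set (ℝ → Omega → U) :=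
  {u | Measurable (Function.uncurry u) ∧
    ∀ j < π.n, ∃ (Γ : ℕ → Set Omega) (w : ℕ → ℝ → Omega → U),
      (∀ k, MeasurableSet[Fsig j] (Γ k)) ∧
      Pairwise (Function.onFun Disjoint Γ) ∧
      (⋃ k, Γ k) = univ ∧
      (∀ k s, Measurable[Gsig j] (w k s)) ∧
      (∀ k, ∀ ω ∈ Γ k, ∀ s ∈ Ico (π.t j) (π.t (j + 1)), u s ω = w k s ω)}

/-- Admissible controls for Player 2 along the partition `π` (with `𝓗_j` in place of `𝓖_j`). -/
def AdmControl2 {T : ℝ} (π : Partition T) : Set (ℝ → Omega → V) :=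
  {v | Measurable (Function.uncurry v) ∧
    ∀ j < π.n, ∃ (Γ : ℕ → Set Omega) (w : ℕ → ℝ → Omega → V),
      (∀ k, MeasurableSet[Fsig j] (Γ k)) ∧
      Pairwise (Function.onFun Disjoint Γ) ∧
      (⋃ k, Γ k) = univ ∧
      (∀ k s, Measurable[Hsig j] (w k s)) ∧
      (∀ k, ∀ ω ∈ Γ k, ∀ s ∈ Ico (π.t j) (π.t (j + 1)), v s ω = w k s ω)}

/-! ### Nonanticipative strategies with delay (NAD strategies) -/

/-- A stopping time `τ : Ω → {0, 1, …, n-1}` of the discrete filtration `(𝓕_j)_j`. -/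
def IsStoppingIdx {T : ℝ} (π : Partition T) (τ : Omega → ℕ) : Prop :=
  (∀ ω, τ ω < π.n) ∧ ∀ j, MeasurableSet[Fsig j] {ω | τ ω = j}

variable {U V}

/-- `u = u'`, `ds⊗dP`-a.e. on the stochastic interval `[[t, b]] = {(s,ω) | t ≤ s ≤ b ω}`. -/
def aeStEq {α : Type*} (P : Measure Omega) (t : ℝ) (b : Omega → ℝ)
    (u u' : ℝ → Omega → α) : Prop :=
  ∀ᵐ p ∂((volume : Measure ℝ).prod P), t ≤ p.1 → p.1 ≤ b p.2 → u p.1 p.2 = u' p.1 p.2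

/-- `u = u'`, `ds⊗dP`-a.e. on `[a,b] × Ω`. -/
def aeEqIcc {α : Type*} (P : Measure Omega) (a b : ℝ) (u u' : ℝ → Omega → α) : Prop :=
  ∀ᵐ p ∂((volume : Measure ℝ).prod P), p.1 ∈ Icc a b → u p.1 p.2 = u' p.1 p.2

variable (U V)

/-- NAD strategies for Player 1 on `[t,T]` along `π`: maps from admissible controls of Player 2 to
admissible controls of Player 1 such that controls agreeing `ds⊗dP`-a.e. on `[[t, t_τ]]`, for a
stopping time `τ`, are mapped to controls agreeing `ds⊗dP`-a.e. on `[[t, t_{τ+1}]]`. -/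
def IsNAD1 {T : ℝ} (P : Measure Omega) (π : Partition T) (t : ℝ)
    (α : (ℝ → Omega → V) → (ℝ → Omega → U)) : Prop :=
  (∀ v ∈ AdmControl2 V π, α v ∈ AdmControl1 U π) ∧
  ∀ τ : Omega → ℕ, IsStoppingIdx π τ →
    ∀ v v', v ∈ AdmControl2 V π → v' ∈ AdmControl2 V π →
      aeStEq P t (fun ω => π.t (τ ω)) v v' →
      aeStEq P t (fun ω => π.t (τ ω + 1)) (α v) (α v')

/-- NAD strategies for Player 2 on `[t,T]` along `π`. -/
def IsNAD2 {T : ℝ} (P : Measure Omega) (π : Partition T) (t : ℝ)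
    (β : (ℝ → Omega → U) → (ℝ → Omega → V)) : Prop :=
  (∀ u ∈ AdmControl1 U π, β u ∈ AdmControl2 V π) ∧
  ∀ τ : Omega → ℕ, IsStoppingIdx π τ →
    ∀ u u', u ∈ AdmControl1 U π → u' ∈ AdmControl1 U π →
      aeStEq P t (fun ω => π.t (τ ω)) u u' →
      aeStEq P t (fun ω => π.t (τ ω + 1)) (β u) (β u')

/-! ### The controlled dynamics -/

variable {U V}
variable {d : ℕ}

/-- `X` is the (continuous) solution on `[t,T]` of `X_s = x + ∫_t^s f(r, X_r, u_r, v_r) dr`. -/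
def IsSol (f : ℝ → EuclideanSpace ℝ (Fin d) → U → V → EuclideanSpace ℝ (Fin d)) (T t : ℝ)
    (x : EuclideanSpace ℝ (Fin d)) (u : ℝ → U) (v : ℝ → V)
    (X : ℝ → EuclideanSpace ℝ (Fin d)) : Prop :=
  ContinuousOn X (Icc t T) ∧ ∀ s ∈ Icc t T, X s = x + ∫ r in t..s, f r (X r) (u r) (v r)

/-- The solution `X^{t,x,u,v}` (chosen via the axiom of choice; under the standing assumptions it
is the unique continuous solution). -/
def sol (f : ℝ → EuclideanSpace ℝ (Fin d) → U → V → EuclideanSpace ℝ (Fin d)) (T t : ℝ)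
    (x : EuclideanSpace ℝ (Fin d)) (u : ℝ → U) (v : ℝ → V) : ℝ → EuclideanSpace ℝ (Fin d) :=
  Classical.epsilon (IsSol f T t x u v)

/-- `(u,v)` is the couple of admissible controls associated with the couple of NAD strategies
`(α,β)` on `[t, tl]`:  `α(v) = u` and `β(u) = v`, `ds⊗dP`-a.e. on `[t,tl] × Ω`. -/
def IsFixPair {T : ℝ} (P : Measure Omega) (π : Partition T) (t tl : ℝ)
    (α : (ℝ → Omega → V) → (ℝ → Omega → U)) (β : (ℝ → Omega → U) → (ℝ → Omega → V))
    (u : ℝ → Omega → U) (v : ℝ → Omega → V) : Prop :=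
  u ∈ AdmControl1 U π ∧ v ∈ AdmControl2 V π ∧ aeEqIcc P t tl (α v) u ∧ aeEqIcc P t tl (β u) v

variable [Nonempty U] [Nonempty V]

/-- The couple of admissible controls associated with a couple of NAD strategies on `[t,tl]`
(chosen via the axiom of choice; by Lemma 2.1 it exists and is `ds⊗dP`-a.e. unique). -/
def fixPair {T : ℝ} (P : Measure Omega) (π : Partition T) (t tl : ℝ)
    (α : (ℝ → Omega → V) → (ℝ → Omega → U)) (β : (ℝ → Omega → U) → (ℝ → Omega → V)) :
    (ℝ → Omega → U) × (ℝ → Omega → V) :=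
  Classical.epsilon fun p => IsFixPair P π t tl α β p.1 p.2

/-- The state process `X^{t,x,α,β}` associated with a couple of NAD strategies on `[t,tl]`. -/
def solStrat (f : ℝ → EuclideanSpace ℝ (Fin d) → U → V → EuclideanSpace ℝ (Fin d)) {T : ℝ}
    (P : Measure Omega) (π : Partition T) (t tl : ℝ) (x : EuclideanSpace ℝ (Fin d))
    (α : (ℝ → Omega → V) → (ℝ → Omega → U)) (β : (ℝ → Omega → U) → (ℝ → Omega → V))
    (s : ℝ) (ω : Omega) : EuclideanSpace ℝ (Fin d) :=
  sol f T t x (fun r => (fixPair P π t tl α β).1 r ω) (fun r => (fixPair P π t tl α β).2 r ω) s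

/-- The terminal pay-off `g(X_T^{t,x,α,β})`. -/
def payoff (f : ℝ → EuclideanSpace ℝ (Fin d) → U → V → EuclideanSpace ℝ (Fin d))
    (g : EuclideanSpace ℝ (Fin d) → ℝ) {T : ℝ} (P : Measure Omega) (π : Partition T)
    (t : ℝ) (x : EuclideanSpace ℝ (Fin d))
    (α : (ℝ → Omega → V) → (ℝ → Omega → U)) (β : (ℝ → Omega → U) → (ℝ → Omega → V)) :
    Omega → ℝ :=
  fun ω => g (solStrat f P π t T x α β T ω)

/-! ### Essential suprema/infima of families of random variables -/

/-- `S` is the `P`-a.s. least upper bound of the family `(ξ_i)_{i}` of random variables. -/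
def IsEssSupFam {ι : Sort*} (P : Measure Omega) (ξ : ι → Omega → ℝ) (S : Omega → ℝ) : Prop :=
  (∀ i, ξ i ≤ᵐ[P] S) ∧ ∀ W : Omega → ℝ, (∀ i, ξ i ≤ᵐ[P] W) → S ≤ᵐ[P] W

/-- `S` is the `P`-a.s. greatest lower bound of the family `(ξ_i)_{i}` of random variables. -/
def IsEssInfFam {ι : Sort*} (P : Measure Omega) (ξ : ι → Omega → ℝ) (S : Omega → ℝ) : Prop :=
  (∀ i, S ≤ᵐ[P] ξ i) ∧ ∀ W : Omega → ℝ, (∀ i, W ≤ᵐ[P] ξ i) → W ≤ᵐ[P] S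

/-! ### Value functions along a partition -/

variable (U V)

/-- The defining property of the lower value function along `π`:
`S = esssup_{α} essinf_{β} E[g(X_T^{t,x,α,β}) | 𝓕_i]` for `t_i ≤ t < t_{i+1}`. -/
def IsLowerVal (f : ℝ → EuclideanSpace ℝ (Fin d) → U → V → EuclideanSpace ℝ (Fin d))
    (g : EuclideanSpace ℝ (Fin d) → ℝ) {T : ℝ} (P : Measure Omega) (π : Partition T)
    (t : ℝ) (x : EuclideanSpace ℝ (Fin d)) (S : Omega → ℝ) : Prop :=
  ∃ J : {α // IsNAD1 U V P π t α} → Omega → ℝ,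
    (∀ α, IsEssInfFam P
      (fun β : {β // IsNAD2 U V P π t β} => P[payoff f g P π t x α.1 β.1 | Fsig (π.idx t)])
      (J α)) ∧
    IsEssSupFam P J S

/-- The defining property of the upper value function along `π`. -/
def IsUpperVal (f : ℝ → EuclideanSpace ℝ (Fin d) → U → V → EuclideanSpace ℝ (Fin d))
    (g : EuclideanSpace ℝ (Fin d) → ℝ) {T : ℝ} (P : Measure Omega) (π : Partition T)
    (t : ℝ) (x : EuclideanSpace ℝ (Fin d)) (S : Omega → ℝ) : Prop :=
  ∃ J : {β // IsNAD2 U V P π t β} → Omega → ℝ,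
    (∀ β, IsEssSupFam P
      (fun α : {α // IsNAD1 U V P π t α} => P[payoff f g P π t x α.1 β.1 | Fsig (π.idx t)])
      (J β)) ∧
    IsEssInfFam P J S

/-- The lower value function along `π` seen as a random variable. -/
def lowerVal (f : ℝ → EuclideanSpace ℝ (Fin d) → U → V → EuclideanSpace ℝ (Fin d))
    (g : EuclideanSpace ℝ (Fin d) → ℝ) {T : ℝ} (P : Measure Omega) (π : Partition T)
    (t : ℝ) (x : EuclideanSpace ℝ (Fin d)) : Omega → ℝ :=
  Classical.epsilon (IsLowerVal U V f g P π t x)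

/-- The upper value function along `π` seen as a random variable. -/
def upperVal (f : ℝ → EuclideanSpace ℝ (Fin d) → U → V → EuclideanSpace ℝ (Fin d))
    (g : EuclideanSpace ℝ (Fin d) → ℝ) {T : ℝ} (P : Measure Omega) (π : Partition T)
    (t : ℝ) (x : EuclideanSpace ℝ (Fin d)) : Omega → ℝ :=
  Classical.epsilon (IsUpperVal U V f g P π t x)

/-- The (deterministic) lower value function along `π`: the expectation of `lowerVal`. -/
def lowerValD (f : ℝ → EuclideanSpace ℝ (Fin d) → U → V → EuclideanSpace ℝ (Fin d))
    (g : EuclideanSpace ℝ (Fin d) → ℝ) {T : ℝ} (P : Measure Omega) (π : Partition T)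
    (t : ℝ) (x : EuclideanSpace ℝ (Fin d)) : ℝ :=
  ∫ ω, lowerVal U V f g P π t x ω ∂P

/-- The (deterministic) upper value function along `π`: the expectation of `upperVal`. -/
def upperValD (f : ℝ → EuclideanSpace ℝ (Fin d) → U → V → EuclideanSpace ℝ (Fin d))
    (g : EuclideanSpace ℝ (Fin d) → ℝ) {T : ℝ} (P : Measure Omega) (π : Partition T)
    (t : ℝ) (x : EuclideanSpace ℝ (Fin d)) : ℝ :=
  ∫ ω, upperVal U V f g P π t x ω ∂P

/-! ### The Hamiltonian and viscosity solutions -/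

section Hamiltonian

variable (U V : Type) [MetricSpace U] [MetricSpace V] [MeasurableSpace U] [MeasurableSpace V]

/-- `f̃(t,x,μ,ν) = ∫_U ∫_V f(t,x,u,v) μ(du) ν(dv)` for mixed actions `μ ∈ Δ(U)`, `ν ∈ Δ(V)`. -/
def ftilde (f : ℝ → EuclideanSpace ℝ (Fin d) → U → V → EuclideanSpace ℝ (Fin d))
    (t : ℝ) (x : EuclideanSpace ℝ (Fin d)) (μ : ProbabilityMeasure U) (ν : ProbabilityMeasure V) :
    EuclideanSpace ℝ (Fin d) :=
  ∫ u, ∫ v, f t x u v ∂(ν : Measure V) ∂(μ : Measure U)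

/-- The Hamiltonian `sup_{μ ∈ ΔU} inf_{ν ∈ ΔV} f̃(t,x,μ,ν)·p`. -/
def ham (f : ℝ → EuclideanSpace ℝ (Fin d) → U → V → EuclideanSpace ℝ (Fin d))
    (t : ℝ) (x p : EuclideanSpace ℝ (Fin d)) : ℝ :=
  ⨆ μ : ProbabilityMeasure U, ⨅ ν : ProbabilityMeasure V, ⟪ftilde U V f t x μ ν, p⟫

/-- Viscosity subsolution of `∂_t W + sup_μ inf_ν f̃(t,x,μ,ν)·∇W = 0`, `W(T,·) = g`, on
`[0,T] × ℝ^d`. -/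
def IsViscSubsol (f : ℝ → EuclideanSpace ℝ (Fin d) → U → V → EuclideanSpace ℝ (Fin d))
    (g : EuclideanSpace ℝ (Fin d) → ℝ) (T : ℝ) (W : ℝ → EuclideanSpace ℝ (Fin d) → ℝ) : Prop :=
  (∀ x, W T x ≤ g x) ∧
  ∀ φ : ℝ → EuclideanSpace ℝ (Fin d) → ℝ,
    ContDiff ℝ 1 (fun q : ℝ × EuclideanSpace ℝ (Fin d) => φ q.1 q.2) →
    ∀ t x, t ∈ Ico (0 : ℝ) T →
      IsLocalMaxOn (fun q : ℝ × EuclideanSpace ℝ (Fin d) => W q.1 q.2 - φ q.1 q.2)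
        (Icc (0 : ℝ) T ×ˢ univ) (t, x) →
      0 ≤ deriv (fun s => φ s x) t + ham U V f t x (gradient (fun y => φ t y) x)

/-- Viscosity supersolution of `∂_t W + sup_μ inf_ν f̃(t,x,μ,ν)·∇W = 0`, `W(T,·) = g`, on
`[0,T] × ℝ^d`. -/
def IsViscSupersol (f : ℝ → EuclideanSpace ℝ (Fin d) → U → V → EuclideanSpace ℝ (Fin d))
    (g : EuclideanSpace ℝ (Fin d) → ℝ) (T : ℝ) (W : ℝ → EuclideanSpace ℝ (Fin d) → ℝ) : Prop :=
  (∀ x, g x ≤ W T x) ∧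
  ∀ φ : ℝ → EuclideanSpace ℝ (Fin d) → ℝ,
    ContDiff ℝ 1 (fun q : ℝ × EuclideanSpace ℝ (Fin d) => φ q.1 q.2) →
    ∀ t x, t ∈ Ico (0 : ℝ) T →
      IsLocalMinOn (fun q : ℝ × EuclideanSpace ℝ (Fin d) => W q.1 q.2 - φ q.1 q.2)
        (Icc (0 : ℝ) T ×ˢ univ) (t, x) →
      deriv (fun s => φ s x) t + ham U V f t x (gradient (fun y => φ t y) x) ≤ 0

end Hamiltonian

/-! ### Essential suprema and infima -/

section EssentialBounds

variable {ι κ : Type*} {P : Measure Omega}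

theorem IsEssSupFam.ae_eq {ξ : ι → Omega → ℝ} {S S' : Omega → ℝ} (h : IsEssSupFam P ξ S)
    (h' : IsEssSupFam P ξ S') : S =ᵐ[P] S' :=
  (h.2 S' h'.1).antisymm (h'.2 S h.1)

theorem isEssInfFam_iff_neg {ξ : ι → Omega → ℝ} {S : Omega → ℝ} :
    IsEssInfFam P ξ S ↔ IsEssSupFam P (fun i => -ξ i) (-S) := by
  have key : ∀ A B : Omega → ℝ, (A ≤ᵐ[P] B) ↔ (-B ≤ᵐ[P] -A) := fun A B => by
    constructor <;> intro h <;> filter_upwards [h] with ω hω <;> simpa using hω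
  refine and_congr (forall_congr' fun i => key _ _) ⟨fun h W hW => ?_, fun h W hW => ?_⟩
  · rw [key, neg_neg]
    exact h _ fun i => by rw [key, neg_neg]; exact hW i
  · rw [key]
    exact h _ fun i => (key _ _).1 (hW i)

theorem IsEssInfFam.neg {ξ : ι → Omega → ℝ} {S : Omega → ℝ} (h : IsEssInfFam P ξ S) :
    IsEssSupFam P (fun i => -ξ i) (-S) :=
  isEssInfFam_iff_neg.1 h

theorem IsEssSupFam.neg {ξ : ι → Omega → ℝ} {S : Omega → ℝ} (h : IsEssSupFam P ξ S) :
    IsEssInfFam P (fun i => -ξ i) (-S) :=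
  isEssInfFam_iff_neg.2 (by simpa using h)

/-- A uniformly bounded family of random variables has an essential supremum. -/
theorem exists_isEssSupFam [IsProbabilityMeasure P] [Nonempty ι] (ξ : ι → Omega → ℝ) (C : ℝ)
    (hm : ∀ i, AEStronglyMeasurable (ξ i) P) (hb : ∀ i, ∀ᵐ ω ∂P, |ξ i ω| ≤ C) :
    ∃ S, IsEssSupFam P ξ S ∧ AEStronglyMeasurable S P ∧ ∀ᵐ ω ∂P, |S ω| ≤ C := by
  have hLp : ∀ i, MemLp (ξ i) 1 P := fun i => MemLp.of_bound (hm i) C (hb i)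
  let F : ι → Lp ℝ 1 P := fun i => (hLp i).toLp (ξ i)
  have : Fact ((1 : ℝ≥0∞) ≠ ∞) := ⟨ENNReal.one_ne_top⟩
  have : MeasurableSpace.CountablyGenerated Omega := inferInstance
  have : SecondCountableTopology (Lp ℝ 1 P) := inferInstance
  have : Nonempty (range F) := (range_nonempty F).to_subtype
  choose s hs using fun n => (TopologicalSpace.denseSeq (range F) n).2
  let S : Omega → ℝ := fun ω => ⨆ n, ξ (s n) ω
  have hbs : ∀ᵐ ω ∂P, ∀ n, |ξ (s n) ω| ≤ C := ae_all_iff.2 fun n => hb (s n)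
  have hbdd : ∀ᵐ ω ∂P, BddAbove (range fun n => ξ (s n) ω) := by
    filter_upwards [hbs] with ω hω
    exact ⟨C, by rintro _ ⟨n, rfl⟩; exact (abs_le.1 (hω n)).2⟩
  have hSm : AEStronglyMeasurable S P :=
    (AEMeasurable.iSup fun n => (hm (s n)).aemeasurable).aestronglyMeasurable
  have hSb : ∀ᵐ ω ∂P, |S ω| ≤ C := by
    filter_upwards [hbs, hbdd] with ω hω hω'
    exact abs_le.2 ⟨(abs_le.1 (hω 0)).1.trans (le_ciSup hω' 0),
      ciSup_le fun n => (abs_le.1 (hω n)).2⟩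
  have hSLp : MemLp S 1 P := MemLp.of_bound hSm C hSb
  have hle : ∀ f : range F, (f : Lp ℝ 1 P) ≤ hSLp.toLp S := by
    refine fun f => isClosed_property (TopologicalSpace.denseRange_denseSeq (range F))
      (isClosed_le continuous_subtype_val continuous_const) (fun n => ?_) f
    rw [← hs n, ← Lp.coeFn_le]
    filter_upwards [(hLp (s n)).coeFn_toLp, hSLp.coeFn_toLp, hbdd] with ω h₁ h₂ h₃
    rw [h₁, h₂]
    exact le_ciSup h₃ n
  refine ⟨S, ⟨fun i => ?_, fun W hW => ?_⟩, hSm, hSb⟩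
  · have h := hle ⟨F i, i, rfl⟩
    rw [← Lp.coeFn_le] at h
    filter_upwards [h, (hLp i).coeFn_toLp, hSLp.coeFn_toLp] with ω h₁ h₂ h₃
    rwa [h₂, h₃] at h₁
  · filter_upwards [ae_all_iff.2 fun n => hW (s n)] with ω hω
    exact ciSup_le hω

/-- `S` is the essential supremum over `a` of the essential infima over `b` of `K a b`. -/
def IsEssSupInf (P : Measure Omega) (K : ι → κ → Omega → ℝ) (S : Omega → ℝ) : Prop :=
  ∃ J : ι → Omega → ℝ, (∀ a, IsEssInfFam P (K a) (J a)) ∧ IsEssSupFam P J S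

theorem exists_isEssSupInf [IsProbabilityMeasure P] [Nonempty ι] [Nonempty κ]
    (K : ι → κ → Omega → ℝ) (C : ℝ) (hm : ∀ a b, AEStronglyMeasurable (K a b) P)
    (hb : ∀ a b, ∀ᵐ ω ∂P, |K a b ω| ≤ C) :
    ∃ S, IsEssSupInf P K S ∧ AEStronglyMeasurable S P := by
  have h := fun a => exists_isEssSupFam (fun b => -K a b) C (fun b => (hm a b).neg)
    (fun b => by simpa using hb a b)
  choose J hJ hJm hJb using h
  obtain ⟨S, hS, hSm, -⟩ := exists_isEssSupFam (fun a => -J a) C (fun a => (hJm a).neg)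
    (fun a => by simpa using hJb a)
  exact ⟨S, ⟨_, fun a => by simpa using (hJ a).neg, hS⟩, hSm⟩

theorem IsEssSupFam.congr {ξ ξ' : ι → Omega → ℝ} {S : Omega → ℝ} (h : IsEssSupFam P ξ S)
    (hξ : ∀ i, ξ i =ᵐ[P] ξ' i) : IsEssSupFam P ξ' S :=
  ⟨fun i => (hξ i).symm.trans_le (h.1 i), fun W hW => h.2 W fun i => (hξ i).trans_le (hW i)⟩

theorem IsEssInfFam.ae_eq {ξ : ι → Omega → ℝ} {S S' : Omega → ℝ} (h : IsEssInfFam P ξ S)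
    (h' : IsEssInfFam P ξ S') : S =ᵐ[P] S' :=
  (h'.2 S h.1).antisymm (h.2 S' h'.1)

theorem IsEssSupInf.ae_eq {K : ι → κ → Omega → ℝ} {S S' : Omega → ℝ} (h : IsEssSupInf P K S)
    (h' : IsEssSupInf P K S') : S =ᵐ[P] S' := by
  obtain ⟨J, hJ, hS⟩ := h
  obtain ⟨J', hJ', hS'⟩ := h'
  exact (hS.congr fun a => (hJ a).ae_eq (hJ' a)).ae_eq hS'

theorem IsEssSupFam.comp {ξ ξ' : ι → Omega → ℝ} {S : Omega → ℝ} (h : IsEssSupFam P ξ S)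
    {θ : Omega ≃ᵐ Omega} (hθ : MeasurePreserving θ P P) {e : ι → ι} (he : e.Surjective)
    (hξ : ∀ i, ξ' (e i) =ᵐ[P] ξ i ∘ θ) : IsEssSupFam P ξ' (S ∘ θ) := by
  refine ⟨fun i => ?_, fun W hW => ?_⟩
  · obtain ⟨i, rfl⟩ := he i
    exact (hξ i).trans_le (hθ.quasiMeasurePreserving.ae (h.1 i))
  · have h₁ : S ≤ᵐ[P] W ∘ θ.symm := h.2 _ fun i => by
      filter_upwards [(hθ.symm θ).quasiMeasurePreserving.ae ((hξ i).symm.trans_le (hW (e i)))]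
        with ω hω
      simpa using hω
    filter_upwards [hθ.quasiMeasurePreserving.ae h₁] with ω hω
    simpa using hω

theorem IsEssInfFam.comp {ξ ξ' : ι → Omega → ℝ} {S : Omega → ℝ} (h : IsEssInfFam P ξ S)
    {θ : Omega ≃ᵐ Omega} (hθ : MeasurePreserving θ P P) {e : ι → ι} (he : e.Surjective)
    (hξ : ∀ i, ξ' (e i) =ᵐ[P] ξ i ∘ θ) : IsEssInfFam P ξ' (S ∘ θ) :=
  isEssInfFam_iff_neg.2 (h.neg.comp (ξ' := fun i => -ξ' i) hθ he fun i => (hξ i).neg)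

theorem IsEssSupInf.comp_ae_eq {K : ι → κ → Omega → ℝ} {S : Omega → ℝ} (h : IsEssSupInf P K S)
    {θ : Omega ≃ᵐ Omega} (hθ : MeasurePreserving θ P P) {e₁ : ι → ι} (he₁ : e₁.Surjective)
    {e₂ : κ → κ} (he₂ : e₂.Surjective) (hK : ∀ a b, K (e₁ a) (e₂ b) =ᵐ[P] K a b ∘ θ) :
    S ∘ θ =ᵐ[P] S := by
  obtain ⟨J, hJ, hS⟩ := h
  exact (hS.comp hθ he₁ fun a => (hJ (e₁ a)).ae_eq ((hJ a).comp hθ he₂ (hK a))).ae_eq hS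

end EssentialBounds

/-! ### Rotations of the sample space -/

section Rotation

/-- The point of `(0,1]` representing an element of the circle, seen as an element of `[0,1]`. -/
def circleRep (z : UnitAddCircle) : I :=
  ⟨AddCircle.measurableEquivIoc 1 0 z, by
    have h := (AddCircle.measurableEquivIoc (1 : ℝ) 0 z).2
    exact ⟨h.1.le, by simpa using h.2⟩⟩

theorem measurable_circleRep : Measurable circleRep :=
  (measurable_subtype_coe.comp (AddCircle.measurableEquivIoc (1 : ℝ) 0).measurable).subtype_mk

theorem circleRep_ne_zero (z : UnitAddCircle) : circleRep z ≠ 0 := by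
  intro h
  have h₁ := (AddCircle.measurableEquivIoc (1 : ℝ) 0 z).2.1
  have h₂ : ((AddCircle.measurableEquivIoc (1 : ℝ) 0 z : Ioc (0 : ℝ) (0 + 1)) : ℝ) = 0 :=
    congrArg Subtype.val h
  exact h₁.ne' h₂

theorem coe_circleRep (z : UnitAddCircle) : (((circleRep z : I) : ℝ) : UnitAddCircle) = z :=
  (AddCircle.equivIoc (1 : ℝ) 0).symm_apply_apply z

theorem circleRep_coe {y : I} (hy : y ≠ 0) : circleRep ((y : ℝ) : UnitAddCircle) = y := by
  have hy' : (y : ℝ) ∈ Ioc (0 : ℝ) (0 + 1) :=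
    ⟨unitInterval.pos_iff_ne_zero.2 hy, by simpa using y.2.2⟩
  exact Subtype.ext (congrArg (Subtype.val : Ioc (0 : ℝ) (0 + 1) → ℝ)
    ((AddCircle.equivIoc (1 : ℝ) 0).apply_symm_apply ⟨y, hy'⟩))

theorem measurePreserving_circleCoe :
    MeasurePreserving (fun y : I => ((y : ℝ) : UnitAddCircle)) volume volume := by
  have h₁ := UnitAddCircle.measurePreserving_mk 0
  have h₂ : MeasurePreserving (Subtype.val : I → ℝ) volume (volume.restrict (Icc 0 1)) :=
    measurePreserving_subtype_coe measurableSet_Icc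
  rw [zero_add, restrict_Ioc_eq_restrict_Icc] at h₁
  exact h₁.comp h₂

theorem measurePreserving_circleRep : MeasurePreserving circleRep volume volume := by
  have hmk := measurePreserving_circleCoe
  refine ⟨measurable_circleRep, ?_⟩
  rw [← hmk.map_eq, Measure.map_map measurable_circleRep hmk.measurable]
  have h0 : ∀ᵐ y : I, y ≠ 0 := by simp [ae_iff]
  rw [Measure.map_congr (g := id) (by filter_upwards [h0] with y hy using circleRep_coe hy),
    Measure.map_id]

/-- The rotation of `(0,1]` by `z`, extended by `0 ↦ 0`. -/
def rot (z : UnitAddCircle) (y : I) : I :=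
  if y = 0 then 0 else circleRep (z + ((y : ℝ) : UnitAddCircle))

theorem rot_neg_rot (z : UnitAddCircle) (y : I) : rot (-z) (rot z y) = y := by
  by_cases hy : y = 0
  · simp [rot, hy]
  · simp [rot, hy, circleRep_ne_zero, coe_circleRep, circleRep_coe]

theorem measurable_rot : Measurable fun p : UnitAddCircle × I => rot p.1 p.2 := by
  have hmk := measurePreserving_circleCoe.measurable
  exact Measurable.ite (measurable_snd (measurableSet_singleton 0)) measurable_const
    (measurable_circleRep.comp (measurable_fst.add (hmk.comp measurable_snd)))

theorem measurePreserving_rot (z : UnitAddCircle) :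
    MeasurePreserving (rot z) volume volume := by
  have h := measurePreserving_circleRep.comp
    ((measurePreserving_add_left volume z).comp measurePreserving_circleCoe)
  refine ⟨measurable_rot.comp measurable_prodMk_left, ?_⟩
  have h0 : ∀ᵐ y : I, y ≠ 0 := by simp [ae_iff]
  exact (Measure.map_congr (by filter_upwards [h0] with y hy using if_neg hy)).trans h.map_eq

theorem measurePreserving_rot_left {y : I} (hy : y ≠ 0) :
    MeasurePreserving (fun a : I => rot ((a : ℝ) : UnitAddCircle) y) volume volume := by
  have h := measurePreserving_circleRep.comp
    ((measurePreserving_add_right volume ((y : ℝ) : UnitAddCircle)).comp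
      measurePreserving_circleCoe)
  convert h using 2 with a
  exact if_neg hy

theorem IsProductMeasure.eq_infinitePi {P : Measure Omega} (hP : IsProductMeasure P) :
    P = Measure.infinitePi fun _ => (volume : Measure (I × I)) := by
  classical
  refine Measure.eq_infinitePi _ fun s t ht => ?_
  obtain ⟨m, hm⟩ := s.exists_nat_subset_range
  let t' : ℕ → Set (I × I) := fun i => if i ∈ s then t i else univ
  have ht' : ∀ i, MeasurableSet (t' i) := fun i => by
    by_cases hi : i ∈ s <;> simp [t', hi, ht]
  have hpre : Set.pi s t =
      (fun (ω : Omega) (i : Fin m) => ω (i : ℕ)) ⁻¹' Set.pi univ fun i : Fin m => t' i := by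
    ext ω
    simp only [Set.mem_pi, mem_preimage, mem_univ, true_imp_iff, t']
    refine ⟨fun h i => ?_, fun h i hi => ?_⟩
    · split_ifs with hi
      exacts [h i hi, mem_univ _]
    · simpa [show i ∈ s from hi] using h ⟨i, Finset.mem_range.1 (hm hi)⟩
  have hmeas : Measurable fun (ω : Omega) (i : Fin m) => ω (i : ℕ) := by fun_prop
  rw [hpre, ← Measure.map_apply hmeas (.univ_pi fun i => ht' i), hP m, Measure.pi_pi,
    Fin.prod_univ_eq_prod_range (fun i => (volume : Measure (I × I)) (t' i)) m,
    ← Finset.prod_subset hm fun i _ hi => by simp [t', hi]]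
  exact Finset.prod_congr rfl fun i hi => by simp [t', hi]

theorem IsProductMeasure.measurePreserving_pi {P : Measure Omega} (hP : IsProductMeasure P)
    {ρ : ℕ → I × I → I × I} (hρ : ∀ j, MeasurePreserving (ρ j) volume volume) :
    MeasurePreserving (fun (ω : Omega) j => ρ j (ω j)) P P := by
  refine ⟨measurable_pi_lambda _ fun j => (hρ j).measurable.comp (measurable_pi_apply j), ?_⟩
  rw [hP.eq_infinitePi, Measure.infinitePi_map_pi _ fun j => (hρ j).measurable]
  simp only [(hρ _).map_eq]

/-- The coordinatewise rotation of the sample space with angles `z`. -/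
def rotOmega (z : ℕ → UnitAddCircle × UnitAddCircle) : Omega ≃ᵐ Omega where
  toFun ω j := (rot (z j).1 (ω j).1, rot (z j).2 (ω j).2)
  invFun ω j := (rot (-(z j).1) (ω j).1, rot (-(z j).2) (ω j).2)
  left_inv ω := by simp [rot_neg_rot]
  right_inv ω := by
    funext j
    have h₁ := rot_neg_rot (-(z j).1) (ω j).1
    have h₂ := rot_neg_rot (-(z j).2) (ω j).2
    rw [neg_neg] at h₁ h₂
    exact Prod.ext h₁ h₂
  measurable_toFun := by
    have := fun z => (measurePreserving_rot z).measurable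
    simp only [Equiv.coe_fn_mk]
    fun_prop
  measurable_invFun := by
    have := fun z => (measurePreserving_rot z).measurable
    simp only [Equiv.coe_fn_symm_mk]
    fun_prop

theorem rotOmega_symm (z : ℕ → UnitAddCircle × UnitAddCircle) :
    (rotOmega z).symm = rotOmega (-z) :=
  MeasurableEquiv.ext rfl

/-- A measure preserving transformation that respects the information structure of the game. -/
structure IsSymmetry (P : Measure Omega) (θ : Omega → Omega) : Prop where
  measurePreserving : MeasurePreserving θ P P
  measurable_Fsig : ∀ j, Measurable[Fsig j, Fsig j] θ
  measurable_Gsig : ∀ j, Measurable[Gsig j, Gsig j] θ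
  measurable_Hsig : ∀ j, Measurable[Hsig j, Hsig j] θ

theorem IsProductMeasure.isSymmetry_rotOmega {P : Measure Omega} (hP : IsProductMeasure P)
    (z : ℕ → UnitAddCircle × UnitAddCircle) : IsSymmetry P (rotOmega z) where
  measurePreserving := hP.measurePreserving_pi (ρ := fun j => Prod.map (rot (z j).1) (rot (z j).2))
    fun j => (measurePreserving_rot _).prod (measurePreserving_rot _)
  measurable_Fsig j := by
    have := fun z => (measurePreserving_rot z).measurable
    rintro _ ⟨s, hs, rfl⟩
    exact ⟨(fun (y : Fin j → I × I) (i : Fin j) =>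
      (rot (z i).1 (y i).1, rot (z i).2 (y i).2)) ⁻¹' s,
      (by fun_prop : Measurable _) hs, rfl⟩
  measurable_Gsig j := by
    rintro _ ⟨s, hs, rfl⟩
    exact ⟨rot (z j).1 ⁻¹' s, (measurePreserving_rot _).measurable hs, rfl⟩
  measurable_Hsig j := by
    rintro _ ⟨s, hs, rfl⟩
    exact ⟨rot (z j).2 ⁻¹' s, (measurePreserving_rot _).measurable hs, rfl⟩

/-- The rotation whose angles are the coordinates of a sample point. -/
def rotBy (a : Omega) : Omega ≃ᵐ Omega :=
  rotOmega fun j => ((((a j).1 : ℝ) : UnitAddCircle), (((a j).2 : ℝ) : UnitAddCircle))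

theorem measurable_rotBy : Measurable fun p : Omega × Omega => rotBy p.1 p.2 := by
  have hmk := measurePreserving_circleCoe.measurable
  have hrot := measurable_rot
  refine measurable_pi_lambda _ fun j => Measurable.prodMk ?_ ?_
  · exact hrot.comp (((hmk.comp measurable_fst).comp ((measurable_pi_apply j).comp
      measurable_fst)).prodMk (measurable_fst.comp ((measurable_pi_apply j).comp measurable_snd)))
  · exact hrot.comp (((hmk.comp measurable_snd).comp ((measurable_pi_apply j).comp
      measurable_fst)).prodMk (measurable_snd.comp ((measurable_pi_apply j).comp measurable_snd)))

theorem IsProductMeasure.ae_measurePreserving_rotBy {P : Measure Omega}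
    (hP : IsProductMeasure P) :
    ∀ᵐ ω ∂P, MeasurePreserving (fun a => rotBy a ω) P P := by
  have h0 : ∀ᵐ y : I, y ≠ 0 := by simp [ae_iff]
  have h1 : ∀ᵐ q : I × I, q.1 ≠ 0 ∧ q.2 ≠ 0 :=
    (Measure.quasiMeasurePreserving_fst.ae h0).and (Measure.quasiMeasurePreserving_snd.ae h0)
  have h2 : ∀ᵐ ω ∂P, ∀ j, (ω j).1 ≠ 0 ∧ (ω j).2 ≠ 0 := by
    rw [hP.eq_infinitePi]
    exact ae_all_iff.2 fun j => (measurePreserving_eval_infinitePi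
      (fun _ : ℕ => (volume : Measure (I × I))) j).quasiMeasurePreserving.ae h1
  filter_upwards [h2] with ω hω
  exact hP.measurePreserving_pi (ρ := fun j => Prod.map
    (fun a : I => rot ((a : ℝ) : UnitAddCircle) (ω j).1)
    (fun a : I => rot ((a : ℝ) : UnitAddCircle) (ω j).2))
    fun j => (measurePreserving_rot_left (hω j).1).prod (measurePreserving_rot_left (hω j).2)

/-- A random variable that is invariant under all rotations is almost surely constant. -/
theorem IsProductMeasure.ae_const_of_rotBy_invariant {P : Measure Omega} [IsProbabilityMeasure P]
    (hP : IsProductMeasure P) {S : Omega → ℝ} (hS : AEStronglyMeasurable S P)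
    (hinv : ∀ a, S ∘ rotBy a =ᵐ[P] S) : ∃ c, S =ᵐ[P] fun _ => c := by
  obtain ⟨S', hS'm, hSS'⟩ := hS
  have hS'meas := hS'm.measurable
  have hinv' : ∀ a, ∀ᵐ ω ∂P, S' (rotBy a ω) = S' ω := fun a => by
    have hmp : MeasurePreserving (rotBy a) P P := (hP.isSymmetry_rotOmega _).measurePreserving
    filter_upwards [hinv a, hSS', hmp.quasiMeasurePreserving.ae hSS'] with ω h₁ h₂ h₃
    rw [← h₂, ← h₁, Function.comp_apply, h₃]
  have hset : MeasurableSet {p : Omega × Omega | S' (rotBy p.1 p.2) = S' p.2} :=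
    measurableSet_eq_fun (hS'meas.comp measurable_rotBy) (hS'meas.comp measurable_snd)
  have hae : ∀ᵐ p ∂P.prod P, S' (rotBy p.1 p.2) = S' p.2 :=
    (Measure.ae_prod_iff_ae_ae hset).2 (ae_of_all _ hinv')
  have hae' : ∀ᵐ ω ∂P, ∀ᵐ a ∂P, S' (rotBy a ω) = S' ω :=
    Measure.ae_ae_of_ae_prod (Measure.measurePreserving_swap.quasiMeasurePreserving.ae hae)
  obtain ⟨ω, hω, hmp⟩ := (hae'.and hP.ae_measurePreserving_rotBy).exists
  refine ⟨S' ω, hSS'.trans ?_⟩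
  have hmeas : MeasurableSet {y | S' y = S' ω} := hS'meas (measurableSet_singleton _)
  have : ∀ᵐ y ∂P.map (fun a => rotBy a ω), S' y = S' ω :=
    (ae_map_iff hmp.measurable.aemeasurable hmeas).2 hω
  rwa [hmp.map_eq] at this

end Rotation

/-! ### Existence and uniqueness of the controls associated with a couple of strategies -/

section FixPair

variable {A B : Type*} {T : ℝ} {P : Measure Omega} {π : Partition T} {t : ℝ}

theorem aeEqIcc_refl (a b : ℝ) (w : ℝ → Omega → A) : aeEqIcc P a b w w :=
  ae_of_all _ fun _ _ => rfl

theorem aeEqIcc.symm {a b : ℝ} {w w' : ℝ → Omega → A} (h : aeEqIcc P a b w w') :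
    aeEqIcc P a b w' w := by
  filter_upwards [h] with p hp hp' using (hp hp').symm

theorem aeEqIcc.trans {a b : ℝ} {w₁ w₂ w₃ : ℝ → Omega → A} (h : aeEqIcc P a b w₁ w₂)
    (h' : aeEqIcc P a b w₂ w₃) : aeEqIcc P a b w₁ w₃ := by
  filter_upwards [h, h'] with p h₁ h₂ hp using (h₁ hp).trans (h₂ hp)

theorem aeEqIcc.mono {a b b' : ℝ} {w w' : ℝ → Omega → A} (h : aeEqIcc P a b w w')
    (hb : b' ≤ b) : aeEqIcc P a b' w w' := by
  filter_upwards [h] with p hp hp' using hp ⟨hp'.1, hp'.2.trans hb⟩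

theorem aeStEq_const_iff {a b : ℝ} {w w' : ℝ → Omega → A} :
    aeStEq P a (fun _ => b) w w' ↔ aeEqIcc P a b w w' := by
  simp only [aeStEq, aeEqIcc, mem_Icc, and_imp]

theorem aeEqIcc_of_le [SFinite P] {a b : ℝ} (hba : b ≤ a) (w w' : ℝ → Omega → A) :
    aeEqIcc P a b w w' := by
  have h : ∀ᵐ s : ℝ, s ≠ a := by simp [ae_iff]
  have h' : ∀ᵐ p ∂(volume : Measure ℝ).prod P, p.1 ≠ a := Measure.quasiMeasurePreserving_fst.ae h
  filter_upwards [h'] with p hp hp'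
  exact absurd (le_antisymm (hp'.2.trans hba) hp'.1) hp

theorem Partition.le_last (π : Partition T) {j : ℕ} (hj : j ≤ π.n) : π.t j ≤ T := by
  refine le_of_le_of_eq ?_ π.map_last
  induction hj using Nat.decreasingInduction with
  | self => exact le_rfl
  | of_succ k hk ih => exact (π.mono k hk).le.trans ih

/-- The common form of `IsNAD1` and `IsNAD2`: nonanticipative maps with delay from the set `𝒟` of
controls to the set `𝒞` of controls. -/
def IsNAD (P : Measure Omega) (π : Partition T) (t : ℝ) (𝒞 : Set (ℝ → Omega → A))
    (𝒟 : Set (ℝ → Omega → B)) (α : (ℝ → Omega → B) → (ℝ → Omega → A)) : Prop :=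
  (∀ v ∈ 𝒟, α v ∈ 𝒞) ∧
  ∀ τ : Omega → ℕ, IsStoppingIdx π τ →
    ∀ v v', v ∈ 𝒟 → v' ∈ 𝒟 →
      aeStEq P t (fun ω => π.t (τ ω)) v v' →
      aeStEq P t (fun ω => π.t (τ ω + 1)) (α v) (α v')

variable {𝒞 : Set (ℝ → Omega → A)} {𝒟 : Set (ℝ → Omega → B)}
  {α : (ℝ → Omega → B) → (ℝ → Omega → A)} {β : (ℝ → Omega → A) → (ℝ → Omega → B)}

theorem IsNAD.const {u : ℝ → Omega → A} (hu : u ∈ 𝒞) : IsNAD P π t 𝒞 𝒟 fun _ => u :=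
  ⟨fun _ _ => hu, fun _ _ _ _ _ _ _ => ae_of_all _ fun _ _ _ => rfl⟩

theorem IsNAD.aeEqIcc_succ (hα : IsNAD P π t 𝒞 𝒟 α) {j : ℕ} (hj : j < π.n)
    {v v' : ℝ → Omega → B} (hv : v ∈ 𝒟) (hv' : v' ∈ 𝒟) (h : aeEqIcc P t (π.t j) v v') :
    aeEqIcc P t (π.t (j + 1)) (α v) (α v') :=
  aeStEq_const_iff.1 (hα.2 (fun _ => j) ⟨fun _ => hj, fun k => MeasurableSet.const (j = k)⟩
    v v' hv hv' (aeStEq_const_iff.2 h))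

theorem IsNAD.exists_fixPair [SFinite P] (ht : 0 ≤ t) (hα : IsNAD P π t 𝒞 𝒟 α)
    (hβ : IsNAD P π t 𝒟 𝒞 β) (h𝒞 : 𝒞.Nonempty) (h𝒟 : 𝒟.Nonempty) :
    ∃ u ∈ 𝒞, ∃ v ∈ 𝒟, aeEqIcc P t T (α v) u ∧ aeEqIcc P t T (β u) v := by
  obtain ⟨u₀, hu₀⟩ := h𝒞
  obtain ⟨v₀, hv₀⟩ := h𝒟
  let F : (ℝ → Omega → A) × (ℝ → Omega → B) → (ℝ → Omega → A) × (ℝ → Omega → B) :=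
    fun p => (α p.2, β p.1)
  let w : ℕ → (ℝ → Omega → A) × (ℝ → Omega → B) := fun k => F^[k] (u₀, v₀)
  have hw : ∀ k, w (k + 1) = (α (w k).2, β (w k).1) := fun k =>
    Function.iterate_succ_apply' F k _
  have hmem : ∀ k, (w k).1 ∈ 𝒞 ∧ (w k).2 ∈ 𝒟 := fun k => by
    induction k with
    | zero => exact ⟨hu₀, hv₀⟩
    | succ k ih => rw [hw]; exact ⟨hα.1 _ ih.2, hβ.1 _ ih.1⟩
  have hstab : ∀ j ≤ π.n, ∀ k, j ≤ k → aeEqIcc P t (π.t j) (w (k + 1)).1 (w k).1 ∧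
      aeEqIcc P t (π.t j) (w (k + 1)).2 (w k).2 := fun j => by
    induction j with
    | zero =>
      have h0 : π.t 0 ≤ t := π.map_zero.trans_le ht
      exact fun _ _ _ => ⟨aeEqIcc_of_le h0 _ _, aeEqIcc_of_le h0 _ _⟩
    | succ j ih =>
      rintro hj (_ | k) hk
      · omega
      · obtain ⟨h₁, h₂⟩ := ih (by omega) k (by omega)
        rw [hw (k + 1), hw k]
        rw [hw k] at h₁ h₂
        have hm := hmem k
        have hm' := hmem (k + 1)
        rw [hw k] at hm'
        exact ⟨hα.aeEqIcc_succ hj hm'.2 hm.2 h₂, hβ.aeEqIcc_succ hj hm'.1 hm.1 h₁⟩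
  have h := hstab π.n le_rfl π.n le_rfl
  rw [hw, π.map_last] at h
  exact ⟨_, (hmem π.n).1, _, (hmem π.n).2, h.1, h.2⟩

theorem IsNAD.fixPair_unique [SFinite P] (ht : 0 ≤ t) (hα : IsNAD P π t 𝒞 𝒟 α)
    (hβ : IsNAD P π t 𝒟 𝒞 β) {u u' : ℝ → Omega → A} {v v' : ℝ → Omega → B}
    (hu : u ∈ 𝒞) (hu' : u' ∈ 𝒞) (hv : v ∈ 𝒟) (hv' : v' ∈ 𝒟)
    (hαv : aeEqIcc P t T (α v) u) (hβu : aeEqIcc P t T (β u) v)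
    (hαv' : aeEqIcc P t T (α v') u') (hβu' : aeEqIcc P t T (β u') v') :
    aeEqIcc P t T u u' ∧ aeEqIcc P t T v v' := by
  suffices h : ∀ j ≤ π.n, aeEqIcc P t (π.t j) u u' ∧ aeEqIcc P t (π.t j) v v' by
    simpa only [π.map_last] using h π.n le_rfl
  intro j
  induction j with
  | zero =>
    have h0 : π.t 0 ≤ t := π.map_zero.trans_le ht
    exact fun _ => ⟨aeEqIcc_of_le h0 _ _, aeEqIcc_of_le h0 _ _⟩
  | succ j ih =>
    intro hj
    obtain ⟨h₁, h₂⟩ := ih (by omega)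
    have hT := π.le_last hj
    exact ⟨((hαv.mono hT).symm.trans (hα.aeEqIcc_succ hj hv hv' h₂)).trans (hαv'.mono hT),
      ((hβu.mono hT).symm.trans (hβ.aeEqIcc_succ hj hu hu' h₁)).trans (hβu'.mono hT)⟩

end FixPair

/-! ### Transport of controls and strategies along symmetries -/

section Transport

variable {A B : Type*} {T : ℝ} {P : Measure Omega} {π : Partition T} {t : ℝ}
  {θ : Omega ≃ᵐ Omega}

/-- The process `w` read along the transformation `θ`. -/
def shiftControl (θ : Omega → Omega) (w : ℝ → Omega → A) : ℝ → Omega → A := fun s ω => w s (θ ω)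

/-- The strategy `α` conjugated by the transformation `θ`. -/
def conjStrat (θ : Omega ≃ᵐ Omega) (α : (ℝ → Omega → B) → (ℝ → Omega → A)) :
    (ℝ → Omega → B) → (ℝ → Omega → A) :=
  fun v => shiftControl θ (α (shiftControl θ.symm v))

theorem shiftControl_symm_shiftControl (θ : Omega ≃ᵐ Omega) (w : ℝ → Omega → A) :
    shiftControl θ.symm (shiftControl θ w) = w := by
  funext s ω
  simp [shiftControl]

theorem shiftControl_shiftControl_symm (θ : Omega ≃ᵐ Omega) (w : ℝ → Omega → A) :
    shiftControl θ (shiftControl θ.symm w) = w := by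
  funext s ω
  simp [shiftControl]

theorem conjStrat_conjStrat_symm (θ : Omega ≃ᵐ Omega)
    (α : (ℝ → Omega → B) → (ℝ → Omega → A)) : conjStrat θ (conjStrat θ.symm α) = α := by
  funext v
  simp only [conjStrat, MeasurableEquiv.symm_symm, shiftControl_shiftControl_symm]

theorem conjStrat_shiftControl (θ : Omega ≃ᵐ Omega) (α : (ℝ → Omega → B) → (ℝ → Omega → A))
    (v : ℝ → Omega → B) : conjStrat θ α (shiftControl θ v) = shiftControl θ (α v) := by
  rw [conjStrat, shiftControl_symm_shiftControl]

theorem aeStEq.shift [SFinite P] {b : Omega → ℝ} {w w' : ℝ → Omega → A}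
    (h : aeStEq P t b w w') (hθ : MeasurePreserving θ P P) :
    aeStEq P t (b ∘ θ) (shiftControl θ w) (shiftControl θ w') :=
  ((MeasurePreserving.id volume).prod hθ).quasiMeasurePreserving.ae h

theorem aeEqIcc.shift [SFinite P] {a b : ℝ} {w w' : ℝ → Omega → A}
    (h : aeEqIcc P a b w w') (hθ : MeasurePreserving θ P P) :
    aeEqIcc P a b (shiftControl θ w) (shiftControl θ w') :=
  ((MeasurePreserving.id volume).prod hθ).quasiMeasurePreserving.ae h

theorem shiftControl_mem_admControl1 {U : Type} [MeasurableSpace U] {u : ℝ → Omega → U}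
    (hu : u ∈ AdmControl1 U π) {φ : Omega → Omega} (hφ : IsSymmetry P φ) :
    shiftControl φ u ∈ AdmControl1 U π := by
  refine ⟨hu.1.comp (measurable_id.prodMap hφ.measurePreserving.measurable), fun j hj => ?_⟩
  obtain ⟨Γ, w, h₁, h₂, h₃, h₄, h₅⟩ := hu.2 j hj
  refine ⟨fun k => φ ⁻¹' Γ k, fun k => shiftControl φ (w k),
    fun k => hφ.measurable_Fsig j (h₁ k), fun k l hkl => (h₂ hkl).preimage φ, ?_,
    fun k s => (h₄ k s).comp (hφ.measurable_Gsig j), fun k ω hω s hs => h₅ k (φ ω) hω s hs⟩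
  rw [← preimage_iUnion, h₃, preimage_univ]

theorem shiftControl_mem_admControl2 {V : Type} [MeasurableSpace V] {v : ℝ → Omega → V}
    (hv : v ∈ AdmControl2 V π) {φ : Omega → Omega} (hφ : IsSymmetry P φ) :
    shiftControl φ v ∈ AdmControl2 V π := by
  refine ⟨hv.1.comp (measurable_id.prodMap hφ.measurePreserving.measurable), fun j hj => ?_⟩
  obtain ⟨Γ, w, h₁, h₂, h₃, h₄, h₅⟩ := hv.2 j hj
  refine ⟨fun k => φ ⁻¹' Γ k, fun k => shiftControl φ (w k),
    fun k => hφ.measurable_Fsig j (h₁ k), fun k l hkl => (h₂ hkl).preimage φ, ?_,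
    fun k s => (h₄ k s).comp (hφ.measurable_Hsig j), fun k ω hω s hs => h₅ k (φ ω) hω s hs⟩
  rw [← preimage_iUnion, h₃, preimage_univ]

theorem const_mem_admControl1 {U : Type} [MeasurableSpace U] (a : U) :
    (fun _ _ => a) ∈ AdmControl1 U π := by
  refine ⟨measurable_const, fun j _ => ⟨fun k => if k = 0 then univ else ∅, fun _ _ _ => a,
    fun k => ?_, fun k l hkl => ?_, ?_, fun _ _ => measurable_const, fun _ _ _ _ _ => rfl⟩⟩
  · dsimp only
    split_ifs
    exacts [@MeasurableSet.univ _ (Fsig j), @MeasurableSet.empty _ (Fsig j)]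
  · simp only [Function.onFun]
    split_ifs <;> simp_all
  · exact eq_univ_of_forall fun ω => mem_iUnion.2 ⟨0, by simp⟩

theorem const_mem_admControl2 {V : Type} [MeasurableSpace V] (b : V) :
    (fun _ _ => b) ∈ AdmControl2 V π := by
  refine ⟨measurable_const, fun j _ => ⟨fun k => if k = 0 then univ else ∅, fun _ _ _ => b,
    fun k => ?_, fun k l hkl => ?_, ?_, fun _ _ => measurable_const, fun _ _ _ _ _ => rfl⟩⟩
  · dsimp only
    split_ifs
    exacts [@MeasurableSet.univ _ (Fsig j), @MeasurableSet.empty _ (Fsig j)]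
  · simp only [Function.onFun]
    split_ifs <;> simp_all
  · exact eq_univ_of_forall fun ω => mem_iUnion.2 ⟨0, by simp⟩

theorem IsNAD.conjStrat [SFinite P] {𝒞 : Set (ℝ → Omega → A)} {𝒟 : Set (ℝ → Omega → B)}
    {α : (ℝ → Omega → B) → (ℝ → Omega → A)} (hα : IsNAD P π t 𝒞 𝒟 α)
    (hθ : IsSymmetry P θ) (hθ' : IsSymmetry P θ.symm)
    (h𝒞 : ∀ u ∈ 𝒞, shiftControl θ u ∈ 𝒞) (h𝒟 : ∀ v ∈ 𝒟, shiftControl θ.symm v ∈ 𝒟) :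
    IsNAD P π t 𝒞 𝒟 (conjStrat θ α) := by
  refine ⟨fun v hv => h𝒞 _ (hα.1 _ (h𝒟 v hv)), fun τ hτ v v' hv hv' h => ?_⟩
  have h' := (hα.2 (τ ∘ θ.symm) ⟨fun ω => hτ.1 _, fun j => hθ'.measurable_Fsig j (hτ.2 j)⟩ _ _
    (h𝒟 v hv) (h𝒟 v' hv') (h.shift hθ'.measurePreserving)).shift hθ.measurePreserving
  simpa [Function.comp_def, DGameFormal.conjStrat] using h'

end Transport

/-! ### Invariance of the pay-off -/

section Payoff

variable {d : ℕ} {A B : Type} {T : ℝ} {P : Measure Omega} {π : Partition T} {t : ℝ}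

theorem sol_congr (f : ℝ → EuclideanSpace ℝ (Fin d) → A → B → EuclideanSpace ℝ (Fin d))
    (x : EuclideanSpace ℝ (Fin d)) {u u' : ℝ → A} {v v' : ℝ → B}
    (hu : ∀ᵐ r, r ∈ Icc t T → u r = u' r) (hv : ∀ᵐ r, r ∈ Icc t T → v r = v' r) :
    sol f T t x u v = sol f T t x u' v' := by
  unfold sol
  congr 1
  funext X
  refine propext (and_congr_right fun _ => forall₂_congr fun s hs => ?_)
  rw [intervalIntegral.integral_congr_ae (g := fun r => f r (X r) (u' r) (v' r))]
  filter_upwards [hu, hv] with r h₁ h₂ hr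
  rw [uIoc_of_le hs.1] at hr
  have hr' : r ∈ Icc t T := ⟨hr.1.le, hr.2.trans hs.2⟩
  rw [h₁ hr', h₂ hr']

theorem aeEqIcc.ae_ae [SFinite P] {a b : ℝ} {w w' : ℝ → Omega → A} (h : aeEqIcc P a b w w') :
    ∀ᵐ ω ∂P, ∀ᵐ r, r ∈ Icc a b → w r ω = w' r ω :=
  Measure.ae_ae_of_ae_prod (Measure.measurePreserving_swap.quasiMeasurePreserving.ae h)

variable [MeasurableSpace A] [MeasurableSpace B] [Nonempty A] [Nonempty B]
  {α : (ℝ → Omega → B) → (ℝ → Omega → A)} {β : (ℝ → Omega → A) → (ℝ → Omega → B)}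

theorem isFixPair_fixPair [SFinite P] (ht : 0 ≤ t) (hα : IsNAD1 A B P π t α)
    (hβ : IsNAD2 A B P π t β) :
    IsFixPair P π t T α β (fixPair P π t T α β).1 (fixPair P π t T α β).2 := by
  obtain ⟨u, hu, v, hv, h⟩ := IsNAD.exists_fixPair ht hα hβ
    ⟨_, const_mem_admControl1 (Classical.arbitrary A)⟩
    ⟨_, const_mem_admControl2 (Classical.arbitrary B)⟩
  exact Classical.epsilon_spec
    (p := fun p : (ℝ → Omega → A) × (ℝ → Omega → B) => IsFixPair P π t T α β p.1 p.2)
    ⟨(u, v), hu, hv, h⟩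

theorem payoff_conjStrat [SFinite P] (ht : 0 ≤ t) (hα : IsNAD1 A B P π t α)
    (hβ : IsNAD2 A B P π t β) {θ : Omega ≃ᵐ Omega} (hθ : IsSymmetry P θ)
    (hθ' : IsSymmetry P θ.symm)
    (f : ℝ → EuclideanSpace ℝ (Fin d) → A → B → EuclideanSpace ℝ (Fin d))
    (g : EuclideanSpace ℝ (Fin d) → ℝ) (x : EuclideanSpace ℝ (Fin d)) :
    payoff f g P π t x (conjStrat θ α) (conjStrat θ β) =ᵐ[P] payoff f g P π t x α β ∘ θ := by
  have hα' : IsNAD1 A B P π t (conjStrat θ α) := IsNAD.conjStrat hα hθ hθ'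
    (fun _ hu => shiftControl_mem_admControl1 hu hθ)
    (fun _ hv => shiftControl_mem_admControl2 hv hθ')
  have hβ' : IsNAD2 A B P π t (conjStrat θ β) := IsNAD.conjStrat hβ hθ hθ'
    (fun _ hv => shiftControl_mem_admControl2 hv hθ)
    (fun _ hu => shiftControl_mem_admControl1 hu hθ')
  obtain ⟨hu, hv, h₁, h₂⟩ := isFixPair_fixPair ht hα hβ
  obtain ⟨hu', hv', h₁', h₂'⟩ := isFixPair_fixPair ht hα' hβ'
  have k₁ := h₁.shift hθ.measurePreserving
  have k₂ := h₂.shift hθ.measurePreserving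
  rw [← conjStrat_shiftControl] at k₁ k₂
  obtain ⟨e₁, e₂⟩ := IsNAD.fixPair_unique ht hα' hβ' hu' (shiftControl_mem_admControl1 hu hθ) hv'
    (shiftControl_mem_admControl2 hv hθ) h₁' h₂' k₁ k₂
  filter_upwards [e₁.ae_ae, e₂.ae_ae] with ω w₁ w₂
  simp only [payoff, solStrat, Function.comp_apply]
  rw [sol_congr f x w₁ w₂]
  rfl

end Payoff

/-! ### Conditional expectations -/

theorem Fsig_le (j : ℕ) : Fsig j ≤ (inferInstance : MeasurableSpace Omega) :=
  Measurable.comap_le (by fun_prop)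

theorem IsSymmetry.condExp_comp {P : Measure Omega} [IsProbabilityMeasure P] {θ : Omega ≃ᵐ Omega}
    (hθ : IsSymmetry P θ) (hθ' : IsSymmetry P θ.symm) (Y : Omega → ℝ) (j : ℕ) :
    P[Y ∘ θ | Fsig j] =ᵐ[P] P[Y | Fsig j] ∘ θ := by
  have hmp := hθ.measurePreserving
  have hint : ∀ Z : Omega → ℝ, Integrable (Z ∘ θ) P ↔ Integrable Z P := fun Z =>
    hmp.integrable_comp_emb θ.measurableEmbedding
  by_cases hY : Integrable Y P
  · refine (ae_eq_condExp_of_forall_setIntegral_eq (Fsig_le j) ((hint Y).2 hY)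
      (fun s _ _ => ((hint _).2 integrable_condExp).integrableOn) (fun s hs _ => ?_) ?_).symm
    · have hs' : MeasurableSet[Fsig j] (θ.symm ⁻¹' s) := hθ'.measurable_Fsig j hs
      have hpre : s = θ ⁻¹' (θ.symm ⁻¹' s) := by ext ω; simp
      have key : ∀ Z : Omega → ℝ,
          ∫ ω in s, (Z ∘ θ) ω ∂P = ∫ ω in θ.symm ⁻¹' s, Z ω ∂P := fun Z => by
        conv_lhs => rw [hpre]
        exact hmp.setIntegral_preimage_emb θ.measurableEmbedding Z _
      rw [key, key, setIntegral_condExp (Fsig_le j) hY hs']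
    · exact (stronglyMeasurable_condExp.comp_measurable
        (hθ.measurable_Fsig j)).aestronglyMeasurable
  · rw [condExp_of_not_integrable hY, condExp_of_not_integrable ((hint Y).not.2 hY)]
    rfl

/-- An essential `sup inf` of bounded random variables that is equivariant under all rotations
exists and is almost surely constant. -/
theorem IsProductMeasure.exists_ae_eq_const_of_isEssSupInf {P : Measure Omega}
    [IsProbabilityMeasure P] (hP : IsProductMeasure P)
    {ι κ : Type*} [Nonempty ι] [Nonempty κ] {K : ι → κ → Omega → ℝ}
    {C : ℝ} (hm : ∀ a b, AEStronglyMeasurable (K a b) P)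
    (hb : ∀ a b, ∀ᵐ ω ∂P, |K a b ω| ≤ C)
    (hK : ∀ z, ∃ (e₁ : ι → ι) (e₂ : κ → κ), e₁.Surjective ∧ e₂.Surjective ∧
      ∀ a b, K (e₁ a) (e₂ b) =ᵐ[P] K a b ∘ rotBy z) :
    ∃ c, (∃ S, IsEssSupInf P K S) ∧ ∀ S, IsEssSupInf P K S → S =ᵐ[P] fun _ => c := by
  obtain ⟨S, hS, hSm⟩ := exists_isEssSupInf K C hm hb
  obtain ⟨c, hc⟩ := hP.ae_const_of_rotBy_invariant hSm fun z => by
    obtain ⟨e₁, e₂, he₁, he₂, h⟩ := hK z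
    exact hS.comp_ae_eq (hP.isSymmetry_rotOmega _).measurePreserving he₁ he₂ h
  exact ⟨c, ⟨S, hS⟩, fun S' hS' => (hS'.ae_eq hS).trans hc⟩

theorem ae_eq_integral_of_ae_eq_const {P : Measure Omega} [IsProbabilityMeasure P]
    {S : Omega → ℝ} {c : ℝ} (h : S =ᵐ[P] fun _ => c) : S =ᵐ[P] fun _ => ∫ ω, S ω ∂P := by
  have : ∫ ω, S ω ∂P = c := by rw [integral_congr_ae h]; simp
  rwa [this]

/-- **Theorem 3.2.** For every partition `Π` and every `(t,x) ∈ [0,T] × ℝ^d`, the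
lower and upper value functions along `Π` are deterministic: `V^Π(t,x) = E[V^Π(t,x)]` and
`U^Π(t,x) = E[U^Π(t,x)]`, `P`-a.s. -/
theorem statement_6
    {d : ℕ} {U V : Type} [MetricSpace U] [CompactSpace U] [MetricSpace V] [CompactSpace V]
    [MeasurableSpace U] [BorelSpace U] [MeasurableSpace V] [BorelSpace V]
    [Nonempty U] [Nonempty V]
    (T : ℝ) (hT : 0 < T)
    (f : ℝ → EuclideanSpace ℝ (Fin d) → U → V → EuclideanSpace ℝ (Fin d))
    (hf_bdd : ∃ C : ℝ, ∀ t x u v, ‖f t x u v‖ ≤ C)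
    (hf_cont : ContinuousOn
      (fun q : ℝ × EuclideanSpace ℝ (Fin d) × U × V => f q.1 q.2.1 q.2.2.1 q.2.2.2)
      (Icc (0 : ℝ) T ×ˢ univ))
    (hf_lip : ∃ K : ℝ≥0, ∀ t u v, LipschitzWith K fun x => f t x u v)
    (g : EuclideanSpace ℝ (Fin d) → ℝ)
    (hg_bdd : ∃ C : ℝ, ∀ x, |g x| ≤ C)
    (hg_lip : ∃ K : ℝ≥0, LipschitzWith K g)
    (P : Measure Omega) [IsProbabilityMeasure P] (hP : IsProductMeasure P)
    (π : Partition T) (t : ℝ) (ht : t ∈ Icc (0 : ℝ) T) (x : EuclideanSpace ℝ (Fin d)) :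
    (lowerVal U V f g P π t x =ᵐ[P] fun _ => ∫ ω, lowerVal U V f g P π t x ω ∂P) ∧
    (upperVal U V f g P π t x =ᵐ[P] fun _ => ∫ ω, upperVal U V f g P π t x ω ∂P) := by
  obtain ⟨C, hC⟩ := hg_bdd
  let K : {α // IsNAD1 U V P π t α} → {β // IsNAD2 U V P π t β} → Omega → ℝ :=
    fun α β => P[payoff f g P π t x α.1 β.1 | Fsig (π.idx t)]
  have : Nonempty {α // IsNAD1 U V P π t α} :=
    ⟨_, IsNAD.const (const_mem_admControl1 (Classical.arbitrary U))⟩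
  have : Nonempty {β // IsNAD2 U V P π t β} :=
    ⟨_, IsNAD.const (const_mem_admControl2 (Classical.arbitrary V))⟩
  have hm : ∀ α β, AEStronglyMeasurable (K α β) P := fun α β =>
    (stronglyMeasurable_condExp.mono (Fsig_le _)).aestronglyMeasurable
  have hb : ∀ α β, ∀ᵐ ω ∂P, |K α β ω| ≤ C.toNNReal := fun α β =>
    ae_bdd_abs_condExp_of_ae_bdd_abs (ae_of_all _ fun ω => (hC _).trans (Real.le_coe_toNNReal C))
  have hK : ∀ z, ∃ (e₁ : {α // IsNAD1 U V P π t α} → {α // IsNAD1 U V P π t α})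
      (e₂ : {β // IsNAD2 U V P π t β} → {β // IsNAD2 U V P π t β}), e₁.Surjective ∧
      e₂.Surjective ∧ ∀ α β, K (e₁ α) (e₂ β) =ᵐ[P] K α β ∘ rotBy z := fun z => by
    have hθ : IsSymmetry P (rotBy z) := hP.isSymmetry_rotOmega _
    have hθ' : IsSymmetry P (rotBy z).symm := by
      rw [rotBy, rotOmega_symm]
      exact hP.isSymmetry_rotOmega _
    have hN₁ : ∀ θ : Omega ≃ᵐ Omega, IsSymmetry P θ → IsSymmetry P θ.symm →
        ∀ α, IsNAD1 U V P π t α → IsNAD1 U V P π t (conjStrat θ α) := fun θ h h' α hα =>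
      IsNAD.conjStrat hα h h' (fun _ hu => shiftControl_mem_admControl1 hu h)
        (fun _ hv => shiftControl_mem_admControl2 hv h')
    have hN₂ : ∀ θ : Omega ≃ᵐ Omega, IsSymmetry P θ → IsSymmetry P θ.symm →
        ∀ β, IsNAD2 U V P π t β → IsNAD2 U V P π t (conjStrat θ β) := fun θ h h' β hβ =>
      IsNAD.conjStrat hβ h h' (fun _ hv => shiftControl_mem_admControl2 hv h)
        (fun _ hu => shiftControl_mem_admControl1 hu h')
    refine ⟨fun α => ⟨conjStrat (rotBy z) α.1, hN₁ _ hθ hθ' _ α.2⟩,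
      fun β => ⟨conjStrat (rotBy z) β.1, hN₂ _ hθ hθ' _ β.2⟩,
      fun α => ⟨⟨conjStrat (rotBy z).symm α.1, hN₁ _ hθ' hθ _ α.2⟩,
        Subtype.ext (conjStrat_conjStrat_symm _ _)⟩,
      fun β => ⟨⟨conjStrat (rotBy z).symm β.1, hN₂ _ hθ' hθ _ β.2⟩,
        Subtype.ext (conjStrat_conjStrat_symm _ _)⟩, fun α β => ?_⟩
    exact (condExp_congr_ae (payoff_conjStrat ht.1 α.2 β.2 hθ hθ' f g x)).trans
      (hθ.condExp_comp hθ' _ _)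
  constructor
  · obtain ⟨c, hex, hc⟩ := hP.exists_ae_eq_const_of_isEssSupInf hm hb hK
    exact ae_eq_integral_of_ae_eq_const
      (hc _ (Classical.epsilon_spec (p := IsLowerVal U V f g P π t x) hex))
  · obtain ⟨c, ⟨S, J, hJ, hS⟩, hc⟩ := hP.exists_ae_eq_const_of_isEssSupInf
      (K := fun β α => -K α β) (fun β α => (hm α β).neg) (C := C.toNNReal)
      (fun β α => by simpa using hb α β) fun z => by
        obtain ⟨e₁, e₂, he₁, he₂, h⟩ := hK z
        exact ⟨e₂, e₁, he₂, he₁, fun β α => (h α β).neg⟩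
    obtain ⟨J', hJ', hS'⟩ := Classical.epsilon_spec (p := IsUpperVal U V f g P π t x)
      ⟨-S, fun β => -J β, fun β => by simpa using (hJ β).neg, hS.neg⟩
    have h := (hc _ ⟨_, fun β => (hJ' β).neg, hS'.neg⟩).neg
    exact ae_eq_integral_of_ae_eq_const (c := -c) ((neg_neg (upperVal U V f g P π t x)) ▸ h)

end DGameFormal
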